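/- 73 divides the class number of the compositum ℚ(3)·ℚ(73), where ℚ(3) is the unique real cubic subfield of ℚ(ζ_9) (the first layer of the cyclotomic ℤ_3-extension of ℚ); equivalently, the 73-class group of ℚ(3)·ℚ(73) is nontrivial. -/

import Mathlib

open NumberField

theorem Ideal.absNorm_modEq_one {M : Type*} [Field M] [NumberField M] {n : ℕ} [NeZero n]
    {ξ : 𝓞 M} (hξ : IsPrimitiveRoot ξ n) (I : Ideal (𝓞 M)) (hI : (absNorm I).Coprime n) :
    absNorm I ≡ 1 [MOD n] := by
  induction I using UniqueFactorizationMonoid.induction_on_prime with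
  | h₁ => simp_all [Nat.modEq_one]
  | h₂ I hu =>
    rw [Ideal.isUnit_iff.mp hu, Ideal.absNorm_top]
  | h₃ I P hI0 hP ih =>
    rw [map_mul] at hI ⊢
    have hPp : P.IsPrime := Ideal.isPrime_of_prime hP
    have hmax : P.IsMaximal := hPp.isMaximal hP.ne_zero
    let := Ideal.Quotient.field P
    have h1 : absNorm P ≠ 1 := absNorm_eq_one_iff.not.mpr hPp.ne_top
    have hprim := hξ.idealQuotient_mk h1 hI.coprime_mul_right
    have hprim' : IsPrimitiveRoot (hprim.isUnit (NeZero.ne n)).unit n :=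
      IsPrimitiveRoot.coe_units_iff.mp hprim
    have hdvd := orderOf_dvd_natCard (hprim.isUnit (NeZero.ne n)).unit
    rw [← hprim'.eq_orderOf, Nat.card_units] at hdvd
    have hpos : 1 ≤ absNorm P := Nat.pos_of_ne_zero (absNorm_eq_zero_iff.not.mpr hP.ne_zero)
    have hP1 : absNorm P ≡ 1 [MOD n] := ((Nat.modEq_iff_dvd' hpos).mpr hdvd).symm
    simpa using hP1.mul (ih hI.coprime_mul_left)

theorem Ideal.absNorm_pow_modEq_one {K M : Type*} [Field K] [NumberField K] [Field M]
    [NumberField M] [Algebra K M] {p : ℕ} [Fact p.Prime] {ξ : 𝓞 M}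
    (hξ : IsPrimitiveRoot ξ (p ^ 2)) (hdeg : ¬ p ∣ Module.finrank K M) (I : Ideal (𝓞 K))
    (hI : (absNorm I).Coprime p) : absNorm I ^ (p - 1) ≡ 1 [MOD p ^ 2] := by
  have hp : p.Prime := Fact.out
  have h1 : absNorm I ^ Module.finrank K M ≡ 1 [MOD p ^ 2] := by
    rw [IsFractionRing.finrank_eq (𝓞 K) K (𝓞 M) M,
      ← Ideal.absNorm_algebraMap (S := 𝓞 M) (𝓞 K) I]
    refine Ideal.absNorm_modEq_one hξ _ ?_
    rw [Ideal.absNorm_algebraMap]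
    exact (hI.pow_left _).pow_right 2
  have h2 : absNorm I ^ (p * (p - 1)) ≡ 1 [MOD p ^ 2] := by
    have := Nat.ModEq.pow_totient (hI.pow_right 2)
    rwa [Nat.totient_prime_pow hp two_pos, show 2 - 1 = 1 from rfl, pow_one] at this
  rw [← ZMod.natCast_eq_natCast_iff] at h1 h2 ⊢
  push_cast at h1 h2 ⊢
  rw [mul_comm, pow_mul] at h2
  have h3 : ((absNorm I : ZMod (p ^ 2)) ^ (p - 1)) ^ Module.finrank K M = 1 := by
    rw [← pow_mul, mul_comm, pow_mul, h1, one_pow]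
  have hc : Nat.Coprime p (Module.finrank K M) := (Nat.Prime.coprime_iff_not_dvd hp).mpr hdeg
  simpa [hc.gcd_eq_one] using pow_gcd_eq_one.mpr ⟨h2, h3⟩

theorem NumberField.RingOfIntegers.dvd_of_algebraMap_dvd {k K : Type*} [Field k] [NumberField k]
    [Field K] [NumberField K] [Algebra k K] {a b : 𝓞 k}
    (h : algebraMap (𝓞 k) (𝓞 K) a ∣ algebraMap (𝓞 k) (𝓞 K) b) : a ∣ b := by
  obtain ⟨w, hw⟩ := h
  by_cases ha : a = 0
  · subst ha
    simpa using hw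
  have ha' : (a : k) ≠ 0 := by simpa using ha
  have hw' : algebraMap k K b = algebraMap k K a * (w : K) := congrArg (algebraMap (𝓞 K) K) hw
  have hint : IsIntegral ℤ ((b : k) / a) := by
    rw [← isIntegral_algebraMap_iff (algebraMap k K).injective, map_div₀, hw',
      mul_div_cancel_left₀ _ ((map_ne_zero _).mpr ha')]
    exact w.isIntegral_coe
  refine ⟨⟨_, hint⟩, ?_⟩
  ext
  exact (mul_div_cancel₀ _ ha').symm

theorem NumberField.RingOfIntegers.algebraMap_norm_eq_prod {k K : Type*} [Field k] [NumberField k]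
    [Field K] [NumberField K] [Algebra k K] [IsGalois k K] (x : 𝓞 K) :
    algebraMap (𝓞 k) (𝓞 K) (RingOfIntegers.norm k x) =
      ∏ σ : Gal(K/k), RingOfIntegers.mapRingHom (σ : K →+* K) x := by
  apply RingOfIntegers.coe_injective
  refine (Algebra.norm_eq_prod_automorphisms k (x : K)).trans ?_
  simp

theorem NumberField.RingOfIntegers.dvd_norm_sub_norm {k K : Type*} [Field k] [NumberField k]
    [Field K] [NumberField K] [Algebra k K] [IsGalois k K] {e : 𝓞 k} {x y : 𝓞 K}
    (h : algebraMap (𝓞 k) (𝓞 K) e ∣ x - y) :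
    e ∣ RingOfIntegers.norm k x - RingOfIntegers.norm k y := by
  apply RingOfIntegers.dvd_of_algebraMap_dvd (K := K)
  rw [map_sub, algebraMap_norm_eq_prod, algebraMap_norm_eq_prod, ← Ideal.mem_span_singleton,
    ← Ideal.Quotient.eq, map_prod, map_prod]
  refine Finset.prod_congr rfl fun σ _ ↦ ?_
  rw [Ideal.Quotient.eq, ← map_sub, Ideal.mem_span_singleton]
  obtain ⟨w, hw⟩ := h
  refine ⟨RingOfIntegers.mapRingHom (σ : K →+* K) w, ?_⟩
  rw [hw, map_mul]
  congr 1
  ext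
  exact σ.commutes _

theorem NumberField.Units.exists_prod_zpow_eq_pow {k ι : Type*} [Field k] [NumberField k]
    [Fintype ι] (hk : Odd (Module.finrank ℚ k)) {p : ℕ} [Fact p.Prime] (hp : Odd p)
    (hι : Units.rank k < Fintype.card ι) (v : ι → (𝓞 k)ˣ) :
    ∃ a : ι → ℤ, (∃ i, ¬ (p : ℤ) ∣ a i) ∧ ∃ w : (𝓞 k)ˣ, ∏ i, v i ^ a i = w ^ p := by
  choose x hx _ using fun i ↦ exist_unique_eq_mul_prod k (v i)
  let f : ι → Fin (rank k) → ZMod p := fun i j ↦ ((x i).2 j : ℤ)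
  have hf : ¬ LinearIndependent (ZMod p) f := fun h ↦ by
    have := h.fintype_card_le_finrank
    simp only [Module.finrank_fin_fun] at this
    lia
  obtain ⟨g, hg, i, hi⟩ := Fintype.not_linearIndependent_iff.mp hf
  have hdvd (j : Fin (rank k)) : ∃ c : ℤ, ∑ i, (x i).2 j * ((g i).val : ℤ) = c * p := by
    simp_rw [mul_comm _ (p : ℤ)]
    change (p : ℤ) ∣ _
    rw [← ZMod.intCast_zmod_eq_zero_iff_dvd]
    simpa [f, mul_comm] using congrFun hg j
  choose c hc using hdvd
  refine ⟨fun i ↦ (g i).val, ⟨i, ?_⟩, ?_⟩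
  · rwa [← ZMod.intCast_zmod_eq_zero_iff_dvd, Int.cast_natCast, ZMod.natCast_zmod_val]
  have hprod : ∏ i, v i ^ ((g i).val : ℤ) =
      ((∏ i, (x i).1 ^ ((g i).val : ℤ) : torsion k) : (𝓞 k)ˣ) *
        (∏ j, fundSystem k j ^ c j) ^ p := by
    conv_lhs => enter [2, i]; rw [hx i, mul_zpow]
    rw [Finset.prod_mul_distrib]
    congr 1
    · simp
    · simp_rw [← Finset.prod_zpow]
      rw [Finset.prod_comm, ← Finset.prod_pow]
      refine Finset.prod_congr rfl fun j _ ↦ ?_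
      simp_rw [← zpow_mul]
      rw [← zpow_natCast (_ ^ _), ← zpow_mul, ← hc j]
      exact (map_sum (zmultiplesHom _ (Additive.ofMul (fundSystem k j))) _ _).symm
  rcases torsion_eq_one_or_neg_one_of_odd_finrank hk
    (∏ i, (x i).1 ^ ((g i).val : ℤ) : torsion k) with h | h
  · exact ⟨_, by rw [hprod, h, one_mul]⟩
  · exact ⟨-∏ j, fundSystem k j ^ c j, by rw [hprod, h, hp.neg_pow, neg_one_mul]⟩

theorem NumberField.Units.rank_lt_finrank (k : Type*) [Field k] [NumberField k] :
    Units.rank k < Module.finrank ℚ k := by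
  have h := InfinitePlace.card_add_two_mul_card_eq_rank k
  have h' := InfinitePlace.card_eq_nrRealPlaces_add_nrComplexPlaces k
  have := Module.finrank_pos (R := ℚ) (M := k)
  rw [Units.rank]
  lia

theorem eq_one_of_zpow_of_prime_pow {G : Type*} [Group G] {p : ℕ} (hp : p.Prime) {g : G}
    (hg : g ^ p = 1) {n : ℤ} (hn : g ^ n = 1) (hnp : ¬ (p : ℤ) ∣ n) : g = 1 := by
  by_contra hne
  have : Fact p.Prime := ⟨hp⟩
  rw [← orderOf_dvd_iff_zpow_eq_one, orderOf_eq_prime hg hne] at hn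
  exact hnp hn

theorem MonoidHom.eq_one_of_prod_zpow_eq_pow {E G H : Type*} [CommGroup E] [CommGroup G]
    [CommGroup H] {p : ℕ} (hp : p.Prime) (t : E →* E) (χ : E →* G) (ψ : E →* H)
    (hχ : ∀ w, χ w ^ p = 1) (hψ : ∀ w, ψ w ^ p = 1) {x u : E} (hχx : χ x = 1)
    (hχt : χ (t x) ≠ 1) (hψx : ψ x = 1) (hψt : ψ (t x) = 1) {a b c : ℤ}
    (habc : ¬ ((p : ℤ) ∣ a ∧ (p : ℤ) ∣ b ∧ (p : ℤ) ∣ c)) {w : E}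
    (hw : u ^ a * x ^ b * t x ^ c = w ^ p) : ψ u = 1 := by
  by_cases ha : (p : ℤ) ∣ a
  · exfalso
    obtain ⟨m, rfl⟩ := ha
    have hc : (p : ℤ) ∣ c := by
      by_contra hc
      refine hχt (eq_one_of_zpow_of_prime_pow hp (hχ _) ?_ hc)
      simpa [hχx, hχ, zpow_mul, zpow_natCast] using congrArg χ hw
    obtain ⟨n, rfl⟩ := hc
    have hb : (p : ℤ) ∣ b := by
      by_contra hb
      refine hχt (eq_one_of_zpow_of_prime_pow hp (hχ _) ?_ hb)
      simpa [hχ, zpow_mul, zpow_natCast] using congrArg (χ.comp t) hw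
    exact habc ⟨⟨m, rfl⟩, hb, ⟨n, rfl⟩⟩
  · refine eq_one_of_zpow_of_prime_pow hp (hψ u) ?_ ha
    simpa [hψx, hψt, hψ] using congrArg ψ hw

theorem NumberField.RingOfIntegers.norm_int_norm {k K : Type*} [Field k] [NumberField k]
    [Field K] [NumberField K] [Algebra k K] (x : 𝓞 K) :
    Algebra.norm ℤ (RingOfIntegers.norm k x) = Algebra.norm ℤ x := by
  have : ((Algebra.norm ℤ (RingOfIntegers.norm k x) : ℤ) : ℚ) = (Algebra.norm ℤ x : ℤ) := by
    rw [Algebra.coe_norm_int, Algebra.coe_norm_int, RingOfIntegers.coe_norm, Algebra.norm_norm]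
  exact_mod_cast this

theorem NumberField.RingOfIntegers.map_norm_pow_eq_one {k K : Type*} [Field k] [NumberField k]
    [Field K] [NumberField K] [Algebra k K] [IsGalois k K] {p : ℕ} (hp : Odd p)
    (hK : ∀ I : Ideal (𝓞 K), (Ideal.absNorm I).Coprime p →
      Ideal.absNorm I ^ (p - 1) ≡ 1 [MOD p ^ 2])
    (t : 𝓞 k →+* 𝓞 k) (ht : ∀ z, ((Algebra.norm ℤ z : ℤ) : 𝓞 k) = z * t z * t (t z))
    (ρ : 𝓞 k →+* ZMod (p ^ 2)) {e : 𝓞 k} (he : ρ e = 1) (het : ρ (t e) = 0)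
    (hett : ρ (t (t e)) = 0) {x : 𝓞 K} (hx : (Ideal.absNorm (Ideal.span {x})).Coprime p) :
    ρ (RingOfIntegers.norm k x) ^ (p - 1) = 1 := by
  set y : 𝓞 K := 1 + algebraMap (𝓞 k) (𝓞 K) e * (x - 1) with hy
  set z : 𝓞 k := RingOfIntegers.norm k y with hz
  obtain ⟨c, hc⟩ : e ∣ z - 1 := by
    simpa using RingOfIntegers.dvd_norm_sub_norm (k := k) (x := y) (y := 1)
      ⟨x - 1, by rw [hy]; ring⟩
  obtain ⟨d, hd⟩ : 1 - e ∣ z - RingOfIntegers.norm k x :=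
    RingOfIntegers.dvd_norm_sub_norm ⟨1 - x, by rw [hy, map_sub, map_one]; ring⟩
  rw [sub_eq_iff_eq_add] at hc hd
  have h1 : ρ z = ρ (RingOfIntegers.norm k x) := by simp [hd, he]
  have h2 : ρ (t z) = 1 := by simp [hc, het]
  have h3 : ρ (t (t z)) = 1 := by simp [hc, hett]
  have hnorm (w : 𝓞 k) :
      ((Algebra.norm ℤ w : ℤ) : ZMod (p ^ 2)) = ρ w * ρ (t w) * ρ (t (t w)) := by
    rw [← map_mul, ← map_mul, ← ht, map_intCast]
  have hyx : ((Algebra.norm ℤ y : ℤ) : ZMod (p ^ 2)) = ρ (RingOfIntegers.norm k x) := by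
    rw [← RingOfIntegers.norm_int_norm (k := k), hnorm, h2, h3, h1, mul_one, mul_one]
  have hspan (w : 𝓞 K) : (Ideal.absNorm (Ideal.span {w})).Coprime p ↔
      IsUnit ((Algebra.norm ℤ w : ℤ) : ZMod (p ^ 2)) := by
    rw [ZMod.coe_int_isUnit_iff_isCoprime, Ideal.absNorm_span_singleton,
      Nat.cast_pow, IsCoprime.pow_left_iff two_pos, isCoprime_comm, Int.isCoprime_iff_gcd_eq_one]
    rfl
  have hcop : (Ideal.absNorm (Ideal.span {y})).Coprime p := by
    rw [hspan, ← RingOfIntegers.norm_int_norm (k := k), hnorm, mul_assoc] at hx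
    rw [hspan, hyx]
    exact isUnit_of_mul_isUnit_left hx
  have := (ZMod.natCast_eq_natCast_iff _ _ _).mpr (hK _ hcop)
  rw [← hyx, ← Int.cast_pow, ← (hp.tsub_odd odd_one).pow_abs, Int.abs_eq_natAbs]
  simpa [Ideal.absNorm_span_singleton] using this

theorem NumberField.RingOfIntegers.norm_eq_intNorm {k K : Type*} [Field k] [NumberField k]
    [Field K] [NumberField K] [Algebra k K] (x : 𝓞 K) :
    RingOfIntegers.norm k x = Algebra.intNorm (𝓞 k) (𝓞 K) x := by
  ext
  rw [RingOfIntegers.coe_norm]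
  exact (Algebra.algebraMap_intNorm (A := 𝓞 k) (K := k) (L := K) x).symm

theorem NumberField.RingOfIntegers.exists_norm_eq_units_mul_pow {k K : Type*} [Field k]
    [NumberField k] [Field K] [NumberField K] [Algebra k K] {q : ℕ} [Fact q.Prime]
    (φ : 𝓞 K →+* ZMod q) {l : 𝓞 k} (hl : φ (algebraMap (𝓞 k) (𝓞 K) l) = 0)
    (hlq : (Algebra.norm ℤ l).natAbs = q) :
    ∃ x : 𝓞 K, Ideal.absNorm (Ideal.span {x}) = q ^ Nat.card (ClassGroup (𝓞 K)) ∧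
      ∃ u : (𝓞 k)ˣ, RingOfIntegers.norm k x = u * l ^ Nat.card (ClassGroup (𝓞 K)) := by
  have hq : q.Prime := Fact.out
  set Q : Ideal (𝓞 K) := RingHom.ker φ with hQ
  have hQq : Ideal.absNorm Q = q := by
    have e := RingHom.quotientKerEquivOfSurjective (ZMod.ringHom_surjective φ)
    rw [Ideal.absNorm_apply, Submodule.cardQuot_apply]
    exact (Nat.card_congr e.toEquiv).trans (Nat.card_zmod q)
  have hlq' : Ideal.absNorm (Ideal.span {l}) = q := by rw [Ideal.absNorm_span_singleton, hlq]
  have hQ0 : Q ≠ ⊥ := fun h ↦ hq.ne_zero (by rw [← hQq, h, Ideal.absNorm_bot])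
  have hmax : (Ideal.span {l}).IsMaximal :=
    (Ideal.isPrime_of_irreducible_absNorm (hlq'.symm ▸ hq.prime.irreducible)).isMaximal
      fun h ↦ hq.ne_zero (by rw [← hlq', h, Ideal.absNorm_bot])
  have hcomap : Ideal.span {l} = Q.comap (algebraMap (𝓞 k) (𝓞 K)) :=
    hmax.eq_of_le (Ideal.comap_ne_top _ (RingHom.ker_ne_top φ))
      ((Ideal.span_singleton_le_iff_mem _).mpr hl)
  have hrel : Ideal.relNorm (𝓞 k) Q = Ideal.span {l} := by
    obtain ⟨J, hJ⟩ := Ideal.dvd_iff_le.mpr (hcomap ▸ Ideal.relNorm_le_comap (𝓞 k) Q)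
    have h := congrArg Ideal.absNorm hJ
    rw [Ideal.absNorm_relNorm, map_mul, hQq, hlq'] at h
    rw [hJ, Ideal.absNorm_eq_one_iff.mp ((mul_eq_left₀ hq.ne_zero).mp h.symm),
      Ideal.mul_top]
  obtain ⟨x, hx⟩ : (Q ^ Nat.card (ClassGroup (𝓞 K))).IsPrincipal := by
    have hmem := mem_nonZeroDivisors_of_ne_zero hQ0
    have h := (ClassGroup.mk0_eq_one_iff (pow_mem hmem (Nat.card (ClassGroup (𝓞 K))))).mp
    refine h ?_
    rw [← pow_card_eq_one' (x := ClassGroup.mk0 ⟨Q, hmem⟩), ← map_pow]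
    rfl
  replace hx : Q ^ Nat.card (ClassGroup (𝓞 K)) = Ideal.span {x} := hx
  refine ⟨x, by rw [← hx, map_pow, hQq], ?_⟩
  have h : Ideal.span {l ^ Nat.card (ClassGroup (𝓞 K))} =
      Ideal.span {RingOfIntegers.norm k x} := by
    rw [norm_eq_intNorm, ← Ideal.relNorm_singleton, ← hx, map_pow, hrel,
      Ideal.span_singleton_pow]
  obtain ⟨u, hu⟩ := Ideal.span_singleton_eq_span_singleton.mp h
  exact ⟨u, by rw [← hu, mul_comm]⟩

theorem ClassGroup.p73_dvd_card_of_cubic {k K : Type*} [Field k] [NumberField k] [Field K]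
    [NumberField K] [Algebra k K] [IsGalois k K] (hk : Module.finrank ℚ k = 3)
    (hK : ∀ I : Ideal (𝓞 K), (Ideal.absNorm I).Coprime 73 →
      Ideal.absNorm I ^ 72 ≡ 1 [MOD 5329])
    (t : 𝓞 k →+* 𝓞 k) (ht : ∀ z, ((Algebra.norm ℤ z : ℤ) : 𝓞 k) = z * t z * t (t z))
    {θ : 𝓞 k} (hθ : θ ^ 3 = 3 * θ - 1) (htθ : t θ = θ ^ 2 - 2)
    (ρ : 𝓞 k →+* ZMod 5329) (hρ : ρ θ = 4501)
    (π : 𝓞 k →+* ZMod 387631) (hπ : π θ = 313116)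
    (φ : 𝓞 K →+* ZMod 95923) (hφ : φ (algebraMap (𝓞 k) (𝓞 K) θ) = 13616) :
    73 ∣ Nat.card (ClassGroup (𝓞 K)) := by
  have : Fact (Nat.Prime 73) := ⟨by norm_num⟩
  have : Fact (Nat.Prime 95923) := ⟨by norm_num⟩
  have : Fact (Nat.Prime 387631) := ⟨by norm_num⟩
  have hodd : Odd 73 := by decide
  have hρt : ρ (t θ) = 3470 := by
    rw [htθ, map_sub, map_pow, hρ, map_ofNat]
    decide
  have hρtt : ρ (t (t θ)) = 2687 := by
    rw [htθ, map_sub, map_pow, map_sub, map_pow, hρt, map_ofNat, map_ofNat]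
    decide
  have hρttt : ρ (t (t (t θ))) = 4501 := by
    rw [htθ, map_sub, map_sub, map_pow, map_pow, map_sub, map_pow, hρtt, map_ofNat, map_ofNat,
      map_ofNat]
    decide
  set l : 𝓞 k := 3 + 17 * θ + 30 * θ ^ 2 with hl
  have hlnorm : (Algebra.norm ℤ l).natAbs = 95923 := by
    have h : Algebra.norm ℤ l = 95923 := by
      have : ((Algebra.norm ℤ l : ℤ) : 𝓞 k) = (95923 : ℤ) := by
        rw [ht, hl]
        simp only [map_add, map_mul, map_pow, map_sub, map_ofNat, htθ]
        push_cast
        linear_combination (-54004 + 75529 * θ + 450948 * θ ^ 2 + 302817 * θ ^ 3 -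
          767167 * θ ^ 4 - 779310 * θ ^ 5 + 537210 * θ ^ 6 + 655830 * θ ^ 7 - 156030 * θ ^ 8 -
          225000 * θ ^ 9 + 15300 * θ ^ 10 + 27000 * θ ^ 11) * hθ
      exact_mod_cast this
    rw [h]
    rfl
  obtain ⟨x, hx, u, hu⟩ := RingOfIntegers.exists_norm_eq_units_mul_pow φ (l := l)
    (by simp only [hl, map_add, map_mul, map_pow, map_ofNat, hφ]; reduce_mod_char) hlnorm
  set h := Nat.card (ClassGroup (𝓞 K))
  have hxcop : (Ideal.absNorm (Ideal.span {x})).Coprime 73 := by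
    rw [hx]
    exact Nat.Coprime.pow_left _ (by norm_num)
  have hnorm1 : ρ (RingOfIntegers.norm k x) ^ 72 = 1 :=
    RingOfIntegers.map_norm_pow_eq_one hodd hK t ht ρ (e := 3379 + 2570 * θ + 87 * θ ^ 2)
      (by simp only [map_add, map_mul, map_pow, map_ofNat, hρ]; decide)
      (by simp only [map_add, map_mul, map_pow, map_ofNat, hρt]; decide)
      (by simp only [map_add, map_mul, map_pow, map_ofNat, hρtt]; decide) hxcop
  have hnorm2 : ρ (t (RingOfIntegers.norm k x)) ^ 72 = 1 :=
    RingOfIntegers.map_norm_pow_eq_one hodd hK t ht (ρ.comp t)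
      (e := 3364 + 2846 * θ + 2759 * θ ^ 2)
      (by simp only [RingHom.comp_apply, map_add, map_mul, map_pow, map_ofNat, hρt]; decide)
      (by simp only [RingHom.comp_apply, map_add, map_mul, map_pow, map_ofNat, hρtt]; decide)
      (by simp only [RingHom.comp_apply, map_add, map_mul, map_pow, map_ofNat, hρttt]; decide)
      hxcop
  let Ψ : 𝓞 k →* ZMod 5329 :=
    (powMonoidHom 72).comp ((powMonoidHom 65).comp (ρ : 𝓞 k →* ZMod 5329) * (ρ.comp t))
  have hΨ (z : 𝓞 k) : Ψ z = (ρ z ^ 65 * ρ (t z)) ^ 72 := rfl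
  have hΨx : Ψ (RingOfIntegers.norm k x) = 1 := by
    rw [hΨ, mul_pow, pow_right_comm, hnorm1, hnorm2, one_pow, one_mul]
  let X : 𝓞 k →* ZMod 387631 := (powMonoidHom 5310).comp (π : 𝓞 k →* ZMod 387631)
  have hX (z : 𝓞 k) : X z = π z ^ 5310 := rfl
  let η : (𝓞 k)ˣ := Units.mkOfMulEqOne θ (3 - θ ^ 2) (by linear_combination -hθ)
  let T : (𝓞 k)ˣ →* (𝓞 k)ˣ := Units.map (t : 𝓞 k →* 𝓞 k)
  have hη : (η : 𝓞 k) = θ := rfl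
  have hTη : ((T η : (𝓞 k)ˣ) : 𝓞 k) = t θ := rfl
  have hΨu : Ψ u = 1 := by
    have hp : Nat.Prime 73 := Fact.out
    obtain ⟨a, ⟨i, hi⟩, w, hw⟩ := Units.exists_prod_zpow_eq_pow (hk ▸ by decide) hodd
      (by rw [Fintype.card_fin]; exact (Units.rank_lt_finrank k).trans_eq hk) ![u, η, T η]
    rw [Fin.prod_univ_three] at hw
    have key : Units.map Ψ u = 1 := by
      refine MonoidHom.eq_one_of_prod_zpow_eq_pow hp T (Units.map X) (Units.map Ψ) ?_ ?_
        (x := η) ?_ ?_ ?_ ?_ (a := a 0) (b := a 1) (c := a 2) ?_ (w := w) hw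
      · intro w
        ext
        rw [Units.val_pow_eq_pow_val, Units.coe_map, hX, ← pow_mul]
        exact ZMod.pow_card_sub_one_eq_one (w.isUnit.map π).ne_zero
      · intro w
        have hw : Units.map Ψ w = (Units.map (ρ : 𝓞 k →* ZMod 5329) w ^ 65 *
          Units.map (ρ.comp t : 𝓞 k →* ZMod 5329) w) ^ 72 := by
          ext
          rw [Units.coe_map, hΨ]
          simp
        rw [hw, ← pow_mul]
        convert ZMod.pow_totient _
        exact (Nat.totient_prime_pow hp two_pos).symm
      · ext
        rw [Units.coe_map, hX, hη, hπ, Units.val_one]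
        reduce_mod_char
      · rw [Ne, Units.ext_iff, Units.coe_map, hX, hTη, htθ, map_sub, map_pow,
          hπ, map_ofNat, Units.val_one]
        reduce_mod_char
        decide
      · ext
        rw [Units.coe_map, hΨ, hη, hρ, hρt, Units.val_one]
        reduce_mod_char
      · ext
        rw [Units.coe_map, hΨ, hTη, hρt, hρtt, Units.val_one]
        reduce_mod_char
      · rintro ⟨h0, h1, h2⟩
        fin_cases i <;> exact hi (by assumption)
    exact congrArg Units.val key
  by_contra hdvd
  have hcop : Nat.Coprime 73 h := (Nat.Prime.coprime_iff_not_dvd Fact.out).mpr hdvd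
  have hΨl : Ψ l = 2921 := by
    rw [hΨ]
    simp only [hl, map_add, map_mul, map_pow, map_ofNat, hρ, hρt]
    reduce_mod_char
  have hΨlh : Ψ l ^ h = 1 := by
    rw [← hΨx, hu, map_mul, map_pow, hΨu, one_mul]
  have hΨl73 : Ψ l ^ 73 = 1 := by
    rw [hΨl]
    reduce_mod_char
  have hone := pow_gcd_eq_one.mpr ⟨hΨl73, hΨlh⟩
  rw [hcop.gcd_eq_one, pow_one, hΨl] at hone
  exact absurd hone (by decide)

theorem IsPrimitiveRoot.exists_ringHom_of_eval_cyclotomic {N R : Type*} [Field N] [NumberField N]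
    {n : ℕ} [NeZero n] [IsCyclotomicExtension {n} ℚ N] {ζ : N} (hζ : IsPrimitiveRoot ζ n)
    [CommRing R] {r : R} (hr : (Polynomial.cyclotomic n R).eval r = 0) :
    ∃ f : 𝓞 N →+* R, f hζ.toInteger = r := by
  have h : Polynomial.aeval r (minpoly ℤ hζ.integralPowerBasis.gen) = 0 := by
    have hmin : minpoly ℤ ζ = minpoly ℤ hζ.toInteger :=
      minpoly.algebraMap_eq RingOfIntegers.coe_injective hζ.toInteger
    rw [hζ.integralPowerBasis_gen, ← hmin,
      ← Polynomial.cyclotomic_eq_minpoly hζ (NeZero.pos n),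
      Polynomial.aeval_def, Polynomial.eval₂_eq_eval_map, Polynomial.map_cyclotomic, hr]
  refine ⟨hζ.integralPowerBasis.lift r h, ?_⟩
  have := hζ.integralPowerBasis.lift_gen r h
  rwa [hζ.integralPowerBasis_gen] at this

theorem IsPrimitiveRoot.pow_six_add_pow_three_add_one {R : Type*} [CommRing R] [IsDomain R]
    {ζ : R} (hζ : IsPrimitiveRoot ζ (3 ^ 2)) : ζ ^ 6 + ζ ^ 3 + 1 = 0 := by
  have h : (ζ ^ 3 - 1) * (ζ ^ 6 + ζ ^ 3 + 1) = 0 := by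
    linear_combination hζ.pow_eq_one
  exact (mul_eq_zero.mp h).resolve_left
    (sub_ne_zero.mpr (hζ.pow_ne_one_of_pos_of_lt (by norm_num) (by norm_num)))

theorem Algebra.norm_eq_of_finrank_eq_three {F k : Type*} [Field F] [Field k] [Algebra F k]
    [IsGalois F k] (hk : Module.finrank F k = 3) {τ : Gal(k/F)} (hτ : τ ≠ 1) (z : k) :
    algebraMap F k (Algebra.norm F z) = z * τ z * τ (τ z) := by
  have : Fact (Nat.Prime 3) := ⟨Nat.prime_three⟩
  have : FiniteDimensional F k := Module.finite_of_finrank_pos (by lia)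
  have hcard : Nat.card Gal(k/F) = 3 := (IsGalois.card_aut_eq_finrank F k).trans hk
  have hgen (σ : Gal(k/F)) : σ ∈ Subgroup.zpowers τ := mem_zpowers_of_prime_card hcard hτ
  classical
  rw [Algebra.norm_eq_prod_automorphisms, ← IsCyclic.image_range_card hgen, Finset.prod_image,
    hcard]
  · simp [Finset.prod_range_succ]
  · rw [← orderOf_eq_card_of_forall_mem_zpowers hgen, Finset.coe_range]
    exact pow_injOn_Iio_orderOf

theorem IsPrimitiveRoot.exists_algebraMap_eq_add_pow_eight {k N : Type*} [Field k] [NumberField k]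
    [Field N] [NumberField N] [IsCyclotomicExtension {3 ^ 2} ℚ N] [Algebra k N] {ζ : N}
    (hζ : IsPrimitiveRoot ζ (3 ^ 2)) (hk : Module.finrank ℚ k = 3) :
    ∃ θ : 𝓞 k, algebraMap (𝓞 k) (𝓞 N) θ = hζ.toInteger + hζ.toInteger ^ 8 := by
  have : IsAbelianGalois ℚ N := IsCyclotomicExtension.isAbelianGalois {3 ^ 2} ℚ N
  have : IsGalois k N := IsGalois.tower_top_of_isGalois ℚ k N
  have hN : Module.finrank k N = 2 := by
    have h := Module.finrank_mul_finrank ℚ k N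
    rw [hk, IsCyclotomicExtension.Rat.finrank (3 ^ 2) N,
      Nat.totient_prime_pow Nat.prime_three two_pos] at h
    lia
  have hmem : ζ + ζ ^ 8 ∈ Set.range (algebraMap k N) := by
    rw [IsGalois.mem_range_algebraMap_iff_fixed]
    intro σ
    have hσ : σ (σ ζ) = ζ := by
      have h := pow_card_eq_one' (x := σ)
      rw [IsGalois.card_aut_eq_finrank, hN, pow_two] at h
      exact DFunLike.congr_fun h ζ
    obtain ⟨a, ha, hcop, haζ⟩ :=
      hζ.isPrimitiveRoot_iff.mp (hζ.map_of_injective σ.injective)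
    rw [← haζ, map_pow, ← haζ, ← pow_mul] at hσ
    have hdvd : 3 ^ 2 ∣ a * a - 1 := by
      have ha0 : a ≠ 0 := by
        rintro rfl
        norm_num at hcop
      refine hζ.dvd_of_pow_eq_one _ (mul_right_cancel₀ (hζ.ne_zero (by norm_num)) ?_)
      rw [pow_sub_one_mul (mul_ne_zero ha0 ha0), hσ, one_mul]
    have h9 := hζ.pow_eq_one
    rw [map_add, map_pow, ← haζ]
    norm_num at ha h9
    interval_cases a <;> first | (exfalso; revert hdvd hcop; decide) | skip
    · ring
    · linear_combination (ζ ^ 55 + ζ ^ 46 + ζ ^ 37 + ζ ^ 28 + ζ ^ 19 + ζ ^ 10 + ζ) * h9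
  obtain ⟨x, hx⟩ := hmem
  have hint : IsIntegral ℤ x := by
    rw [← isIntegral_algebraMap_iff (algebraMap k N).injective, hx]
    have := hζ.isIntegral (NeZero.pos _)
    exact this.add (this.pow 8)
  refine ⟨⟨x, hint⟩, ?_⟩
  ext
  exact hx

theorem IsPrimitiveRoot.exists_ringHom_norm_eq {k N : Type*} [Field k] [NumberField k]
    [Field N] [NumberField N] [IsCyclotomicExtension {3 ^ 2} ℚ N] [Algebra k N] {ζ : N}
    (hζ : IsPrimitiveRoot ζ (3 ^ 2)) (hk : Module.finrank ℚ k = 3) {θ : 𝓞 k}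
    (hθ : algebraMap (𝓞 k) (𝓞 N) θ = hζ.toInteger + hζ.toInteger ^ 8) :
    θ ^ 3 = 3 * θ - 1 ∧ ∃ t : 𝓞 k →+* 𝓞 k, t θ = θ ^ 2 - 2 ∧
      ∀ z, ((Algebra.norm ℤ z : ℤ) : 𝓞 k) = z * t z * t (t z) := by
  have : IsAbelianGalois ℚ N := IsCyclotomicExtension.isAbelianGalois {3 ^ 2} ℚ N
  have : IsAbelianGalois ℚ k := .tower_bot ℚ k N
  have h9 := hζ.pow_eq_one
  norm_num at h9
  have h63 := hζ.pow_six_add_pow_three_add_one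
  have hθN : algebraMap k N θ = ζ + ζ ^ 8 := congrArg (algebraMap (𝓞 N) N) hθ
  have hθ3 : (θ : k) ^ 3 = 3 * θ - 1 := by
    apply (algebraMap k N).injective
    simp only [map_pow, map_sub, map_mul, map_ofNat, map_one, hθN]
    linear_combination h63 + (3 * ζ + 3 * ζ ^ 8 + ζ ^ 6 + ζ ^ 15) * h9
  let σ : Gal(N/ℚ) := (IsCyclotomicExtension.Rat.galEquivZMod (3 ^ 2) N).symm
    (ZMod.unitOfCoprime 2 (by decide))
  have hσ : σ ζ = ζ ^ 2 := by
    rw [IsCyclotomicExtension.Rat.galEquivZMod_apply_of_pow_eq (3 ^ 2) N σ hζ.pow_eq_one,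
      MulEquiv.apply_symm_apply, ZMod.coe_unitOfCoprime]
    rfl
  let τ : Gal(k/ℚ) := σ.restrictNormal k
  have hτ : τ θ = (θ : k) ^ 2 - 2 := by
    apply (algebraMap k N).injective
    rw [AlgEquiv.restrictNormal_commutes]
    simp only [map_pow, map_sub, map_add, map_ofNat, hθN, hσ]
    linear_combination -2 * h9
  have hτ1 : τ ≠ 1 := by
    intro h
    rw [h, AlgEquiv.one_apply] at hτ
    exact three_ne_zero (by linear_combination hθ3 + (θ + 1 : k) * hτ : (3 : k) = 0)
  refine ⟨RingOfIntegers.ext hθ3, RingOfIntegers.mapRingHom (τ : k →+* k),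
    RingOfIntegers.ext hτ, fun z ↦ ?_⟩
  ext
  have h := Algebra.norm_eq_of_finrank_eq_three hk hτ1 (z : k)
  rw [← Algebra.coe_norm_int] at h
  simpa using h

theorem IsPrimitiveRoot.of_pow_eq_one_of_pow_ne_one {R : Type*} [CommRing R] {r : R} {p q : ℕ}
    (hp : p.Prime) (hq : q.Prime) (h : r ^ (p ^ 2 * q ^ 2) = 1) (h₁ : r ^ (p * q ^ 2) ≠ 1)
    (h₂ : r ^ (p ^ 2 * q) ≠ 1) : IsPrimitiveRoot r (p ^ 2 * q ^ 2) := by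
  rw [IsPrimitiveRoot.iff_orderOf]
  have := hp.pos
  have := hq.pos
  refine orderOf_eq_of_pow_and_pow_div_prime (by positivity) h fun l hl hdvd ↦ ?_
  rcases hl.dvd_mul.mp hdvd with hd | hd
  · rw [(Nat.prime_dvd_prime_iff_eq hl hp).mp (hl.dvd_of_dvd_pow hd)]
    rwa [show p ^ 2 * q ^ 2 = p * (p * q ^ 2) by ring, Nat.mul_div_cancel_left _ hp.pos]
  · rw [(Nat.prime_dvd_prime_iff_eq hl hq).mp (hl.dvd_of_dvd_pow hd)]
    rwa [show p ^ 2 * q ^ 2 = q * (p ^ 2 * q) by ring, Nat.mul_div_cancel_left _ hq.pos]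

theorem IsPrimitiveRoot.isCyclotomicExtension_adjoin_simple {K L : Type*} [Field K] [Field L]
    [Algebra K L] {n : ℕ} [NeZero n] {ζ : L} (hζ : IsPrimitiveRoot ζ n) :
    IsCyclotomicExtension {n} K (IntermediateField.adjoin K {ζ}) := by
  change IsCyclotomicExtension {n} K (IntermediateField.adjoin K {ζ}).toSubalgebra
  rw [IntermediateField.adjoin_simple_toSubalgebra_of_isAlgebraic
    (hζ.isIntegral (NeZero.pos n)).tower_top.isAlgebraic]
  exact hζ.adjoin_isCyclotomicExtension K

theorem Polynomial.eval_cyclotomic_three_sq {R : Type*} [CommRing R] (r : R) :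
    (Polynomial.cyclotomic (3 ^ 2) R).eval r = 1 + r ^ 3 + r ^ 6 := by
  rw [show 3 ^ 2 = 3 ^ (1 + 1) from rfl,
    Polynomial.cyclotomic_prime_pow_eq_geom_sum Nat.prime_three]
  simp [Finset.sum_range_succ, ← pow_mul]

/-- `73` divides the class number of the compositum `ℚ(3)·ℚ(73)`, where `ℚ(3)` is the unique
real cubic subfield of `ℚ(ζ₉)` (the first layer of the cyclotomic `ℤ₃`-extension of `ℚ`) and
`ℚ(73)` is the unique degree-`73` subfield of `ℚ(ζ_{73²})`, the compositum being taken
inside `ℂ`. -/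
theorem p73_dvd_classNumber
    (K₁ K₂ : IntermediateField ℚ ℂ)
    (ζ : ℂ) (hζ : IsPrimitiveRoot ζ (3 ^ 2))
    (hK₁sub : K₁ ≤ IntermediateField.adjoin ℚ {ζ})
    (hK₁deg : Module.finrank ℚ K₁ = 3)
    (ξ : ℂ) (hξ : IsPrimitiveRoot ξ (73 ^ 2))
    (hK₂sub : K₂ ≤ IntermediateField.adjoin ℚ {ξ})
    (hK₂deg : Module.finrank ℚ K₂ = 73) :
    73 ∣ Nat.card (ClassGroup (𝓞 ↥(K₁ ⊔ K₂))) := by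
  have h73 : Nat.Prime 73 := by norm_num
  have : Fact (Nat.Prime 73) := ⟨h73⟩
  have : Fact (Nat.Prime 95923) := ⟨by norm_num⟩
  set N : IntermediateField ℚ ℂ := IntermediateField.adjoin ℚ {ζ}
  set M : IntermediateField ℚ ℂ := IntermediateField.adjoin ℚ {ζ * ξ}
  have hμ : IsPrimitiveRoot (ζ * ξ) (3 ^ 2 * 73 ^ 2) := by
    rw [IsPrimitiveRoot.iff_orderOf, (Commute.all ζ ξ).orderOf_mul_eq_mul_orderOf_of_coprime,
      ← hζ.eq_orderOf, ← hξ.eq_orderOf]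
    rw [← hζ.eq_orderOf, ← hξ.eq_orderOf]
    decide
  have hμζ : (ζ * ξ) ^ 5329 = ζ := by
    rw [mul_pow, ← pow_mod_orderOf ζ 5329, ← pow_mod_orderOf ξ 5329, ← hζ.eq_orderOf,
      ← hξ.eq_orderOf]
    norm_num
  have hμξ : (ζ * ξ) ^ 42633 = ξ := by
    rw [mul_pow, ← pow_mod_orderOf ζ 42633, ← pow_mod_orderOf ξ 42633, ← hζ.eq_orderOf,
      ← hξ.eq_orderOf]
    norm_num
  have hζM : ζ ∈ M := by
    rw [← hμζ]
    exact pow_mem (IntermediateField.mem_adjoin_simple_self ℚ _) _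
  have hξM : ξ ∈ M := by
    rw [← hμξ]
    exact pow_mem (IntermediateField.mem_adjoin_simple_self ℚ _) _
  have hKM : K₁ ⊔ K₂ ≤ M :=
    sup_le (hK₁sub.trans (IntermediateField.adjoin_simple_le_iff.mpr hζM))
      (hK₂sub.trans (IntermediateField.adjoin_simple_le_iff.mpr hξM))
  have : FiniteDimensional ℚ K₁ := Module.finite_of_finrank_pos (by lia)
  have : FiniteDimensional ℚ K₂ := Module.finite_of_finrank_pos (by lia)
  have : NumberField K₁ := { to_finiteDimensional := ‹FiniteDimensional ℚ K₁› }
  have : NumberField ↥(K₁ ⊔ K₂) :=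
    { to_finiteDimensional := IntermediateField.finiteDimensional_sup K₁ K₂ }
  have : IsCyclotomicExtension {3 ^ 2} ℚ N :=
    hζ.isCyclotomicExtension_adjoin_simple
  have : IsCyclotomicExtension {3 ^ 2 * 73 ^ 2} ℚ M :=
    hμ.isCyclotomicExtension_adjoin_simple
  have : NumberField N := IsCyclotomicExtension.numberField {3 ^ 2} ℚ N
  have : NumberField M := IsCyclotomicExtension.numberField {3 ^ 2 * 73 ^ 2} ℚ M
  let _ : Algebra K₁ N := (IntermediateField.inclusion hK₁sub).toAlgebra
  let _ : Algebra K₁ ↥(K₁ ⊔ K₂) := (IntermediateField.inclusion le_sup_left).toAlgebra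
  let _ : Algebra ↥(K₁ ⊔ K₂) M := (IntermediateField.inclusion hKM).toAlgebra
  have hζN : IsPrimitiveRoot (⟨ζ, IntermediateField.mem_adjoin_simple_self ℚ ζ⟩ : N) (3 ^ 2) :=
    IsPrimitiveRoot.coe_submonoidClass_iff.mp hζ
  have hμM : IsPrimitiveRoot (⟨ζ * ξ, IntermediateField.mem_adjoin_simple_self ℚ _⟩ : M)
      (3 ^ 2 * 73 ^ 2) := IsPrimitiveRoot.coe_submonoidClass_iff.mp hμ
  have : IsAbelianGalois ℚ M := IsCyclotomicExtension.isAbelianGalois {3 ^ 2 * 73 ^ 2} ℚ M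
  have : IsAbelianGalois ℚ ↥(K₁ ⊔ K₂) := .tower_bot ℚ ↥(K₁ ⊔ K₂) M
  have : IsGalois K₁ ↥(K₁ ⊔ K₂) := IsGalois.tower_top_of_isGalois ℚ K₁ ↥(K₁ ⊔ K₂)
  have hdeg : ¬ 73 ∣ Module.finrank ↥(K₁ ⊔ K₂) M := by
    intro h
    have h' : 73 ∣ Module.finrank ℚ ↥(K₁ ⊔ K₂) :=
      hK₂deg ▸ IntermediateField.finrank_dvd_of_le_right le_sup_right
    have h'' := mul_dvd_mul h' h
    have hM' : Module.finrank ℚ M = (3 ^ 2 * 73 ^ 2).totient :=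
      IsCyclotomicExtension.Rat.finrank (3 ^ 2 * 73 ^ 2) M
    have htot : (3 ^ 2 * 73 ^ 2).totient = 31536 := by
      rw [Nat.totient_mul (by norm_num), Nat.totient_prime_pow Nat.prime_three two_pos,
        Nat.totient_prime_pow h73 two_pos]
      norm_num
    rw [Module.finrank_mul_finrank ℚ ↥(K₁ ⊔ K₂) M, hM', htot] at h''
    norm_num at h''
  have hK (I : Ideal (𝓞 ↥(K₁ ⊔ K₂))) (hI : (Ideal.absNorm I).Coprime 73) :
      Ideal.absNorm I ^ 72 ≡ 1 [MOD 5329] :=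
    Ideal.absNorm_pow_modEq_one (hμM.toInteger_isPrimitiveRoot.pow (by positivity) rfl) hdeg I hI
  obtain ⟨θ, hθ⟩ := hζN.exists_algebraMap_eq_add_pow_eight hK₁deg
  obtain ⟨hθ3, t, htθ, ht⟩ := hζN.exists_ringHom_norm_eq hK₁deg hθ
  obtain ⟨ρ, hρ⟩ := hζN.exists_ringHom_of_eval_cyclotomic (r := (527 : ZMod 5329)) (by
    rw [Polynomial.eval_cyclotomic_three_sq]
    decide)
  obtain ⟨π, hπ⟩ := hζN.exists_ringHom_of_eval_cyclotomic (r := (43556 : ZMod 387631)) (by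
    rw [Polynomial.eval_cyclotomic_three_sq]
    decide)
  obtain ⟨φ, hφ⟩ := hμM.exists_ringHom_of_eval_cyclotomic (r := (49 : ZMod 95923)) (by
    refine IsPrimitiveRoot.isRoot_cyclotomic (by norm_num)
      (.of_pow_eq_one_of_pow_ne_one Nat.prime_three h73 ?_ ?_ ?_)
    · norm_num
      reduce_mod_char
    · norm_num
      reduce_mod_char
      decide
    · norm_num
      reduce_mod_char
      decide)
  have hθC : ((θ : K₁) : ℂ) = ζ + ζ ^ 8 := congrArg (fun z : 𝓞 N ↦ ((z : N) : ℂ)) hθ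
  have hθM : algebraMap (𝓞 ↥(K₁ ⊔ K₂)) (𝓞 M) (algebraMap (𝓞 K₁) (𝓞 ↥(K₁ ⊔ K₂)) θ) =
      hμM.toInteger ^ 5329 + (hμM.toInteger ^ 5329) ^ 8 := by
    have hμC : ((algebraMap (𝓞 M) M hμM.toInteger : M) : ℂ) = ζ * ξ := rfl
    ext
    refine hθC.trans ?_
    simp only [map_add, map_pow, IntermediateField.coe_add, IntermediateField.coe_pow]
    rw [hμC, hμζ]
  refine ClassGroup.p73_dvd_card_of_cubic hK₁deg hK t ht hθ3 htθ
    (ρ.comp (algebraMap (𝓞 K₁) (𝓞 N))) ?_ (π.comp (algebraMap (𝓞 K₁) (𝓞 N))) ?_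
    (φ.comp (algebraMap (𝓞 ↥(K₁ ⊔ K₂)) (𝓞 M))) ?_
  · rw [RingHom.comp_apply, hθ, map_add, map_pow, hρ]
    reduce_mod_char
  · rw [RingHom.comp_apply, hθ, map_add, map_pow, hπ]
    reduce_mod_char
  · rw [RingHom.comp_apply, hθM]
    simp only [map_add, map_pow, hφ]
    reduce_mod_char
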